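/- Let p be a prime and n ∈ ℕ. Then the Touchard-type congruence b_{n+p}(x) = b_{n+1}(x) + x^p · b_n(x) holds in the polynomial ring (ℤ/pℤ)[x], where b_m(x) denotes the Bell polynomial with coefficients reduced modulo p. -/

import Mathlib

/-- Stirling numbers of the second kind. -/
def stirling2 : ℕ → ℕ → ℕ
  | 0, 0 => 1
  | 0, _ + 1 => 0
  | _ + 1, 0 => 0
  | n + 1, j + 1 => (j + 1) * stirling2 n (j + 1) + stirling2 n j

/-- Evaluation of the Bell polynomial `b_n(x) = ∑_j S(n,j) x^j`. -/
def bellEval {R : Type*} [CommRing R] (n : ℕ) (x : R) : R :=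
  ∑ j ∈ Finset.range (n + 1), (stirling2 n j : R) * x ^ j

theorem stirling2_eq_zero_of_lt {n j : ℕ} (h : n < j) : stirling2 n j = 0 := by
  induction n generalizing j with
  | zero => obtain ⟨j, rfl⟩ := Nat.exists_eq_succ_of_ne_zero h.ne'; rfl
  | succ n ih =>
    obtain ⟨j, rfl⟩ := Nat.exists_eq_succ_of_ne_zero (Nat.ne_zero_of_lt h)
    simp [stirling2, ih (show n < j by lia), ih (show n < j + 1 by lia)]

section

open Polynomial

/-- The operator `f ↦ x (f + f')`, which sends each Bell polynomial to the next one. -/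
noncomputable def bellOperator (R : Type*) [CommRing R] : Module.End R R[X] :=
  LinearMap.mulLeft R X * (1 + derivative)

section CommRing

variable {R : Type*} [CommRing R]

theorem bellOperator_apply (f : R[X]) :
    bellOperator R f = X * (f + derivative f) := by
  simp [bellOperator]

theorem coeff_bellEval_X (n k : ℕ) : (bellEval n (X : R[X])).coeff k = stirling2 n k := by
  simp only [bellEval, finsetSum_coeff, coeff_natCast_mul, coeff_X_pow, mul_ite, mul_one,
    mul_zero, Finset.sum_ite_eq, Finset.mem_range]
  split_ifs with h
  · rfl
  · rw [stirling2_eq_zero_of_lt (by lia), Nat.cast_zero]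

theorem bellEval_succ_X (n : ℕ) :
    bellEval (n + 1) (X : R[X]) = bellOperator R (bellEval n X) := by
  ext k
  rw [bellOperator_apply, coeff_bellEval_X]
  cases k with
  | zero => simp [stirling2]
  | succ k =>
    rw [coeff_X_mul, coeff_add, coeff_derivative, coeff_bellEval_X, coeff_bellEval_X, stirling2]
    push_cast
    ring

theorem bellEval_add_X (n m : ℕ) :
    bellEval (n + m) (X : R[X]) = (bellOperator R ^ m) (bellEval n X) := by
  induction m with
  | zero => simp
  | succ m ih => rw [← add_assoc, bellEval_succ_X, ih, pow_succ', Module.End.mul_apply]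

theorem aeval_bellOperator_descPochhammer (k : ℕ) (f : R[X]) :
    aeval (bellOperator R) (descPochhammer R k) f =
      X ^ k * ((1 + derivative : Module.End R R[X]) ^ k) f := by
  induction k with
  | zero => simp
  | succ k ih =>
    rw [descPochhammer_succ_right, mul_comm, map_mul, Module.End.mul_apply, ih,
      pow_succ' (1 + derivative : Module.End R R[X]), Module.End.mul_apply]
    generalize ((1 + derivative : Module.End R R[X]) ^ k) f = g
    simp only [map_sub, aeval_X, map_natCast, LinearMap.sub_apply, LinearMap.add_apply,
      Module.End.one_apply, Module.End.natCast_apply, bellOperator_apply, derivative_mul,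
      derivative_X_pow, nsmul_eq_mul]
    cases k with
    | zero => simp
    | succ k =>
      simp only [Nat.add_sub_cancel]
      ring

end CommRing

variable (p : ℕ) [Fact p.Prime]

theorem descPochhammer_zmod_eq_X_pow_sub_X : descPochhammer (ZMod p) p = X ^ p - X := by
  have hp : 1 < p := (Fact.out : p.Prime).one_lt
  have hmonic : (X ^ p - X : (ZMod p)[X]).Monic := monic_X_pow_sub (by simpa using hp)
  have hdeg : (X ^ p - X : (ZMod p)[X]).natDegree = p :=
    FiniteField.X_pow_card_sub_X_natDegree_eq (ZMod p) hp
  have hdeg' : (descPochhammer (ZMod p) p).degree = p := by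
    rw [degree_eq_natDegree (monic_descPochhammer _ _).ne_zero, descPochhammer_natDegree]
  refine eq_of_degree_sub_lt_of_eval_finset_eq Finset.univ ?_ fun a _ => ?_
  · refine (degree_sub_lt_left ?_ (monic_descPochhammer _ _).ne_zero ?_).trans_eq ?_
    · rw [hdeg', degree_eq_natDegree hmonic.ne_zero, hdeg]
    · rw [(monic_descPochhammer _ _).leadingCoeff, hmonic.leadingCoeff]
    · simp [hdeg', ZMod.card]
  · rw [descPochhammer_eval_eq_prod_range, eval_sub, eval_pow, eval_X, ZMod.pow_card, sub_self]
    exact Finset.prod_eq_zero (Finset.mem_range.2 a.val_lt) (by simp)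

theorem one_add_derivative_pow_char :
    (1 + derivative : Module.End (ZMod p) (ZMod p)[X]) ^ p = 1 := by
  have : CharP (Module.End (ZMod p) (ZMod p)[X]) p :=
    charP_of_injective_algebraMap (algebraMap (ZMod p) _).injective p
  rw [add_pow_char_of_commute _ (Commute.one_left _), one_pow, add_eq_left]
  refine LinearMap.ext fun f => ?_
  rw [Module.End.pow_apply, ← factorial_smul_hasseDeriv]
  have h : ((p.factorial : ℕ) : (ZMod p)[X]) = 0 :=
    (CharP.cast_eq_zero_iff _ p _).2 (Nat.dvd_factorial (Fact.out : p.Prime).pos le_rfl)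
  simp [nsmul_eq_mul, h]

theorem bellOperator_pow_char_apply (f : (ZMod p)[X]) :
    (bellOperator (ZMod p) ^ p) f = bellOperator (ZMod p) f + X ^ p * f := by
  have h := aeval_bellOperator_descPochhammer p f
  rw [descPochhammer_zmod_eq_X_pow_sub_X, one_add_derivative_pow_char] at h
  simpa [sub_eq_iff_eq_add'] using h

end

/-- The Touchard-type congruence `b_{n+p}(x) = b_{n+1}(x) + x^p b_n(x)` in `(ℤ/pℤ)[x]`. -/
theorem bell_touchard_congruence (p : ℕ) (hp : p.Prime) (n : ℕ) :
    bellEval (n + p) (Polynomial.X : Polynomial (ZMod p)) =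
      bellEval (n + 1) (Polynomial.X : Polynomial (ZMod p)) +
        (Polynomial.X : Polynomial (ZMod p)) ^ p *
          bellEval n (Polynomial.X : Polynomial (ZMod p)) := by
  have : Fact p.Prime := ⟨hp⟩
  rw [bellEval_add_X, bellOperator_pow_char_apply, bellEval_succ_X]
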